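/- Let t > 0, let φ : ℝ^d → ℝ be bounded measurable with |φ| ≤ B, and let α ∈ ℕ^d be a multi-index. Then for every x ∈ ℝ^d, |∂^α P_t φ(x)|² ≤ (α!/(e^{2t} − 1)^{|α|}) · P_t(φ²)(x) ≤ B² α!/(e^{2t} − 1)^{|α|}. -/

import Mathlib

open MeasureTheory ProbabilityTheory Real
open scoped ENNReal NNReal BigOperators Topology Classical

noncomputable section

/-- `ℝ^d` with the Euclidean norm. -/
abbrev Euc (d : ℕ) := EuclideanSpace ℝ (Fin d)

/-- The standard Gaussian measure on `ℝ^d`. -/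
def stdGaussian (d : ℕ) : Measure (Euc d) :=
  volume.withDensity fun x =>
    ENNReal.ofReal ((2 * Real.pi) ^ (-(d : ℝ) / 2) * Real.exp (-‖x‖ ^ 2 / 2))

/-- The Wasserstein distance of order `p` between two measures, valued in `ℝ≥0∞`. -/
def wassersteinDist {E : Type*} [NormedAddCommGroup E] [MeasurableSpace E]
    (p : ℝ) (μ ν : Measure E) : ℝ≥0∞ :=
  ⨅ (cpl : Measure (E × E)) (_ : IsProbabilityMeasure cpl)
    (_ : cpl.map Prod.fst = μ) (_ : cpl.map Prod.snd = ν),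
    (∫⁻ q, ENNReal.ofReal (‖q.1 - q.2‖ ^ p) ∂cpl) ^ (1 / p)

/-- Degree `|α|` of a multi-index. -/
def mdeg {d : ℕ} (α : Fin d → ℕ) : ℕ := ∑ i, α i

/-- Factorial `α!` of a multi-index. -/
def mfact {d : ℕ} (α : Fin d → ℕ) : ℕ := ∏ i, (α i).factorial

/-- Monomial `x^α`. -/
def monoE {d : ℕ} (α : Fin d → ℕ) (x : Euc d) : ℝ := ∏ i, x i ^ α i

/-- The family indexed by multi-indices of degree 2 associated with the identity matrix. -/
def idFam {d : ℕ} (α : Fin d → ℕ) : ℝ := if ∃ i : Fin d, α = Pi.single i 2 then 1 else 0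

/-- Partial derivative in the `i`-th coordinate direction. -/
def pderivE {d : ℕ} (i : Fin d) (f : Euc d → ℝ) : Euc d → ℝ :=
  fun x => fderiv ℝ f x (EuclideanSpace.single i 1)

/-- Iterated partial derivative `∂^α`. -/
def mderivE {d : ℕ} (α : Fin d → ℕ) (f : Euc d → ℝ) : Euc d → ℝ :=
  ((List.ofFn fun i : Fin d => (pderivE i)^[α i]).foldr (· ∘ ·) id) f

/-- `∂^α` applied componentwise to a vector field. -/
def mderivVec {d : ℕ} (α : Fin d → ℕ) (g : Euc d → Euc d) (x : Euc d) : Euc d :=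
  (EuclideanSpace.equiv (Fin d) ℝ).symm fun i => mderivE α (fun y => g y i) x

/-- The Ornstein-Uhlenbeck semigroup `P_t`. -/
def OU {d : ℕ} (t : ℝ) (φ : Euc d → ℝ) (x : Euc d) : ℝ :=
  ∫ y, φ (Real.exp (-t) • x + Real.sqrt (1 - Real.exp (-2 * t)) • y) ∂(stdGaussian d)

/-- The Ornstein-Uhlenbeck semigroup acting componentwise on a vector field. -/
def OUvec {d : ℕ} (t : ℝ) (g : Euc d → Euc d) (x : Euc d) : Euc d :=
  ∫ y, g (Real.exp (-t) • x + Real.sqrt (1 - Real.exp (-2 * t)) • y) ∂(stdGaussian d)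

/-- The `k`-th probabilists' Hermite polynomial, as a function `ℝ → ℝ`. -/
def hermiteR (k : ℕ) (x : ℝ) : ℝ := Polynomial.aeval x (Polynomial.hermite k)

/-- The multivariate Hermite polynomial `H_α`. -/
def hermiteM {d : ℕ} (α : Fin d → ℕ) (x : Euc d) : ℝ := ∏ i, hermiteR (α i) (x i)

/-- The Hilbert–Schmidt norm of the matrix `E[Y Yᵀ]`. -/
def covHS {Ω : Type*} [MeasurableSpace Ω] {d : ℕ} (P : Measure Ω) (Y : Ω → Euc d) : ℝ :=
  Real.sqrt (∑ k, ∑ l, (∫ ω, Y ω k * Y ω l ∂P) ^ 2)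

/-- The Hilbert–Schmidt norm of the matrix `E[Y Yᵀ ‖Y‖^l]`. -/
def covHSw {Ω : Type*} [MeasurableSpace Ω] {d : ℕ} (P : Measure Ω) (Y : Ω → Euc d) (l : ℝ) : ℝ :=
  Real.sqrt (∑ k, ∑ k', (∫ ω, Y ω k * Y ω k' * ‖Y ω‖ ^ l ∂P) ^ 2)

/-- The Hermite function `He_k(u) exp(-u²/2)`. -/
def hermiteW (k : ℕ) (u : ℝ) : ℝ := hermiteR k u * Real.exp (-u ^ 2 / 2)

/-- The tensor product of the Hermite functions `hermiteW (β i)`. -/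
def hermiteProd {d : ℕ} (β : Fin d → ℕ) (u : Euc d) : ℝ := ∏ i, hermiteW (β i) (u i)

lemma exists_abs_aeval_mul_exp_le (P : Polynomial ℤ) :
    ∃ C : ℝ, 0 ≤ C ∧ ∀ u : ℝ,
      |Polynomial.aeval u P * Real.exp (-u ^ 2 / 2)| ≤ C * Real.exp (-u ^ 2 / 4) := by
  suffices h : ∃ C : ℝ, 0 ≤ C ∧ ∀ u : ℝ, |Polynomial.aeval u P| ≤ C * Real.exp (u ^ 2 / 4) by
    obtain ⟨C, hC, h⟩ := h
    refine ⟨C, hC, fun u => ?_⟩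
    rw [abs_mul, abs_of_pos (Real.exp_pos _)]
    calc _ ≤ C * Real.exp (u ^ 2 / 4) * Real.exp (-u ^ 2 / 2) := by gcongr; exact h u
      _ = C * Real.exp (-u ^ 2 / 4) := by
        rw [mul_assoc, ← Real.exp_add]; ring_nf
  induction P using Polynomial.induction_on' with
  | add p q hp hq =>
    obtain ⟨C, hC, h⟩ := hp
    obtain ⟨D, hD, h'⟩ := hq
    refine ⟨C + D, by positivity, fun u => ?_⟩
    rw [map_add, add_mul]
    exact (abs_add_le _ _).trans (add_le_add (h u) (h' u))
  | monomial n a =>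
    refine ⟨|(a : ℝ)| * (1 + 4 ^ n * n.factorial), by positivity, fun u => ?_⟩
    rw [Polynomial.aeval_monomial, abs_mul, mul_assoc]
    simp only [eq_intCast]
    gcongr
    have h1 := Real.pow_div_factorial_le_exp (u ^ 2 / 4) (by positivity) n
    rw [div_le_iff₀ (by positivity), div_pow, div_le_iff₀ (by positivity)] at h1
    have h2 : (1 : ℝ) ≤ Real.exp (u ^ 2 / 4) := Real.one_le_exp (by positivity)
    have h3 : |u ^ n| ≤ 1 + (u ^ 2) ^ n := by
      have : (u ^ 2) ^ n = |u ^ n| ^ 2 := by rw [sq_abs, ← pow_mul, ← pow_mul, mul_comm]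
      nlinarith [sq_nonneg (|u ^ n| - 1)]
    linarith

lemma exp_neg_norm_sq_eq_prod {d : ℕ} (r : ℝ) (y : Euc d) :
    Real.exp (-‖y‖ ^ 2 / r) = ∏ i, Real.exp (-(y i) ^ 2 / r) := by
  rw [← Real.exp_sum, EuclideanSpace.norm_sq_eq, ← Finset.sum_div, Finset.sum_neg_distrib]
  simp

lemma exists_abs_prod_aeval_mul_exp_le {d : ℕ} (P : Fin d → Polynomial ℤ) :
    ∃ C : ℝ, 0 ≤ C ∧ ∀ y : Euc d,
      |∏ i, (Polynomial.aeval (y i) (P i) * Real.exp (-(y i) ^ 2 / 2))| ≤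
        C * Real.exp (-‖y‖ ^ 2 / 4) := by
  choose C hC h using fun i => exists_abs_aeval_mul_exp_le (P i)
  refine ⟨∏ i, C i, Finset.prod_nonneg fun i _ => hC i, fun y => ?_⟩
  rw [Finset.abs_prod, exp_neg_norm_sq_eq_prod, ← Finset.prod_mul_distrib]
  exact Finset.prod_le_prod (fun _ _ => abs_nonneg _) fun i _ => h i (y i)

lemma integrable_exp_neg_mul_norm_sub_sq {d : ℕ} {b : ℝ} (hb : 0 < b) (v : Euc d) :
    Integrable fun y : Euc d => Real.exp (-b * ‖y - v‖ ^ 2) := by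
  have h : Integrable fun y : Euc d => Real.exp (-b * ‖y‖ ^ 2) := by
    have := (GaussianFourier.integrable_cexp_neg_mul_sq_norm_add (b := (b : ℂ)) (V := Euc d)
      (by simpa using hb) 0 0).re
    refine this.congr (ae_of_all _ fun y => ?_)
    simp only [zero_mul, add_zero]
    rw [show (-(b : ℂ) * (‖y‖ : ℂ) ^ 2) = ((-b * ‖y‖ ^ 2 : ℝ) : ℂ) by push_cast; ring,
      ← Complex.ofReal_exp]
    rfl
  exact h.comp_sub_right v

lemma integrable_bounded_mul_prod {d : ℕ} {ψ : Euc d → ℝ} (hψ : Measurable ψ) {B : ℝ}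
    (hB : ∀ y, |ψ y| ≤ B) (P : Fin d → Polynomial ℤ) :
    Integrable fun y : Euc d =>
      ψ y * ∏ i, (Polynomial.aeval (y i) (P i) * Real.exp (-(y i) ^ 2 / 2)) := by
  obtain ⟨C, hC, h⟩ := exists_abs_prod_aeval_mul_exp_le P
  have hB0 : 0 ≤ B := (abs_nonneg _).trans (hB 0)
  refine ((integrable_exp_neg_mul_norm_sub_sq (d := d) (b := 1 / 4) (by norm_num) 0).const_mul
    (B * C)).mono' ?_ (ae_of_all _ fun y => ?_)
  · refine (hψ.mul (Continuous.measurable ?_)).aestronglyMeasurable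
    refine continuous_finsetProd _ fun i _ => Continuous.mul ?_ (by fun_prop)
    exact (Polynomial.continuous_aeval (P i)).comp (by fun_prop)
  · rw [Real.norm_eq_abs, abs_mul, mul_assoc]
    refine mul_le_mul (hB y) ((h y).trans_eq ?_) (abs_nonneg _) hB0
    rw [sub_zero]; ring_nf

lemma hasDerivAt_hermiteW (k : ℕ) (u : ℝ) : HasDerivAt (hermiteW k) (-hermiteW (k + 1) u) u := by
  have h1 := Polynomial.hasDerivAt_aeval (Polynomial.hermite k) u
  have h2 : HasDerivAt (fun u : ℝ => Real.exp (-u ^ 2 / 2)) (Real.exp (-u ^ 2 / 2) * -u) u := by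
    have h3 : HasDerivAt (fun u : ℝ => -u ^ 2 / 2) (-u) u :=
      (((hasDerivAt_pow 2 u).fun_neg).div_const 2).congr_deriv (by simp; ring)
    exact h3.exp
  refine (h1.mul h2).congr_deriv ?_
  simp only [hermiteW, hermiteR, Polynomial.hermite_succ, map_sub, map_mul, Polynomial.aeval_X]
  ring

lemma derivative_hermite_succ (n : ℕ) :
    Polynomial.derivative (Polynomial.hermite (n + 1)) =
      ((n : Polynomial ℤ) + 1) * Polynomial.hermite n := by
  induction n with
  | zero => simp
  | succ n ih =>
    rw [Polynomial.hermite_succ (n + 1)]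
    simp only [Polynomial.derivative_sub, Polynomial.derivative_mul, Polynomial.derivative_X, ih,
      Polynomial.derivative_add, Polynomial.derivative_natCast, Polynomial.derivative_one]
    rw [Polynomial.hermite_succ n]
    push_cast
    ring

lemma hasDerivAt_hermiteR_succ (k : ℕ) (u : ℝ) :
    HasDerivAt (hermiteR (k + 1)) ((k + 1) * hermiteR k u) u := by
  refine (Polynomial.hasDerivAt_aeval (Polynomial.hermite (k + 1)) u).congr_deriv ?_
  rw [derivative_hermite_succ]
  simp [hermiteR]

lemma integrable_aeval_mul_exp (P : Polynomial ℤ) :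
    Integrable fun u : ℝ => Polynomial.aeval u P * Real.exp (-u ^ 2 / 2) := by
  obtain ⟨C, hC, h⟩ := exists_abs_aeval_mul_exp_le P
  refine ((integrable_exp_neg_mul_sq (b := 1 / 4) (by norm_num)).const_mul C).mono' ?_
    (ae_of_all _ fun u => (h u).trans_eq (by ring_nf))
  exact ((Polynomial.continuous_aeval P).mul (by fun_prop)).aestronglyMeasurable

lemma integrable_hermiteR_mul_hermiteW (j k : ℕ) :
    Integrable fun u : ℝ => hermiteR j u * hermiteW k u := by
  refine (integrable_aeval_mul_exp (Polynomial.hermite j * Polynomial.hermite k)).congr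
    (ae_of_all _ fun u => ?_)
  simp [hermiteW, hermiteR, mul_assoc]

lemma integral_hermiteR_mul_hermiteW_self (k : ℕ) :
    ∫ u : ℝ, hermiteR k u * hermiteW k u = k.factorial * √(2 * π) := by
  induction k with
  | zero =>
    simp only [hermiteW, hermiteR, Polynomial.hermite_zero, map_one, one_mul, Nat.factorial_zero,
      Nat.cast_one]
    have := integral_gaussian (1 / 2)
    rw [show π / (1 / 2) = 2 * π by ring] at this
    rw [← this]
    congr 1; ext u; ring_nf
  | succ k ih =>
    have hd : ∀ u, HasDerivAt (fun u => hermiteR (k + 1) u * hermiteW k u)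
        ((k + 1) * (hermiteR k u * hermiteW k u) - hermiteR (k + 1) u * hermiteW (k + 1) u) u :=
      fun u => ((hasDerivAt_hermiteR_succ k u).mul (hasDerivAt_hermiteW k u)).congr_deriv (by ring)
    have i1 := (integrable_hermiteR_mul_hermiteW k k).const_mul (k + 1 : ℝ)
    have i2 := integrable_hermiteR_mul_hermiteW (k + 1) (k + 1)
    have h := integral_eq_zero_of_hasDerivAt_of_integrable hd (i1.sub i2)
      (integrable_hermiteR_mul_hermiteW (k + 1) k)
    rw [integral_sub i1 i2, integral_const_mul, ih] at h
    rw [Nat.factorial_succ]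
    push_cast
    linarith

lemma continuous_hermiteW (k : ℕ) : Continuous (hermiteW k) :=
  continuous_iff_continuousAt.2 fun u => (hasDerivAt_hermiteW k u).continuousAt

lemma continuous_hermiteProd {d : ℕ} (β : Fin d → ℕ) : Continuous (hermiteProd β) :=
  continuous_finsetProd _ fun i _ => (continuous_hermiteW (β i)).comp (by fun_prop)

/-- The Fréchet derivative of `hermiteProd β`. -/
def hermiteProdDeriv {d : ℕ} (β : Fin d → ℕ) (u : Euc d) : Euc d →L[ℝ] ℝ :=
  ∑ i, (-hermiteProd (β + Pi.single i 1) u) • EuclideanSpace.proj i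

lemma hermiteProd_add_single {d : ℕ} (β : Fin d → ℕ) (i : Fin d) (u : Euc d) :
    hermiteProd (β + Pi.single i 1) u =
      (∏ j ∈ Finset.univ.erase i, hermiteW (β j) (u j)) * hermiteW (β i + 1) (u i) := by
  rw [hermiteProd, ← Finset.prod_erase_mul _ _ (Finset.mem_univ i)]
  congr 1
  · refine Finset.prod_congr rfl fun j hj => ?_
    simp [Finset.ne_of_mem_erase hj]
  · simp

lemma hasFDerivAt_hermiteProd {d : ℕ} (β : Fin d → ℕ) (u : Euc d) :
    HasFDerivAt (hermiteProd β) (hermiteProdDeriv β u) u := by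
  have h : ∀ i ∈ (Finset.univ : Finset (Fin d)),
      HasFDerivAt (fun u : Euc d => hermiteW (β i) (u i))
        ((-hermiteW (β i + 1) (u i)) • (EuclideanSpace.proj i : Euc d →L[ℝ] ℝ)) u := fun i _ =>
    HasDerivAt.comp_hasFDerivAt (f := fun u : Euc d => u i) u (hasDerivAt_hermiteW (β i) (u i))
      (EuclideanSpace.proj i : Euc d →L[ℝ] ℝ).hasFDerivAt
  refine (HasFDerivAt.finsetProd h).congr_fderiv ?_
  refine Finset.sum_congr rfl fun i _ => ?_
  rw [hermiteProd_add_single, smul_smul]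
  congr 1
  ring

lemma continuous_hermiteProdDeriv {d : ℕ} (β : Fin d → ℕ) : Continuous (hermiteProdDeriv β) :=
  continuous_finsetSum _ fun _ _ => (continuous_hermiteProd _).neg.smul continuous_const

lemma exists_abs_hermiteProd_le {d : ℕ} (β : Fin d → ℕ) :
    ∃ C : ℝ, 0 ≤ C ∧ ∀ u : Euc d, |hermiteProd β u| ≤ C * Real.exp (-‖u‖ ^ 2 / 4) :=
  exists_abs_prod_aeval_mul_exp_le fun i => Polynomial.hermite (β i)

lemma exists_norm_hermiteProdDeriv_le {d : ℕ} (β : Fin d → ℕ) :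
    ∃ C : ℝ, 0 ≤ C ∧ ∀ u : Euc d, ‖hermiteProdDeriv β u‖ ≤ C * Real.exp (-‖u‖ ^ 2 / 4) := by
  choose C hC h using fun i : Fin d => exists_abs_hermiteProd_le (β + Pi.single i 1)
  refine ⟨∑ i, C i * ‖(EuclideanSpace.proj i : Euc d →L[ℝ] ℝ)‖,
    Finset.sum_nonneg fun i _ => mul_nonneg (hC i) (norm_nonneg _), fun u => ?_⟩
  rw [Finset.sum_mul]
  refine norm_sum_le_of_le _ fun i _ => ?_
  rw [norm_smul, norm_neg, Real.norm_eq_abs, mul_right_comm]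
  exact mul_le_mul_of_nonneg_right (h i u) (norm_nonneg _)

lemma integrable_mul_hermiteProd_sub {d : ℕ} {ψ : Euc d → ℝ} (hψ : Measurable ψ) {B : ℝ}
    (hB : ∀ y, |ψ y| ≤ B) (β : Fin d → ℕ) (v : Euc d) :
    Integrable fun y => ψ y * hermiteProd β (y - v) := by
  have h := integrable_bounded_mul_prod (ψ := fun y => ψ (y + v)) (hψ.comp (by fun_prop))
    (fun y => hB _) (fun i => Polynomial.hermite (β i))
  simpa [hermiteProd, hermiteW, hermiteR] using h.comp_sub_right v

lemma hasFDerivAt_integral_hermiteProd {d : ℕ} {ψ : Euc d → ℝ} (hψ : Measurable ψ) {B : ℝ}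
    (hB : ∀ y, |ψ y| ≤ B) (β : Fin d → ℕ) (c : ℝ) (x₀ : Euc d) :
    Integrable (fun y => (ψ y * -c) • hermiteProdDeriv β (y - c • x₀)) ∧
    HasFDerivAt (fun x => ∫ y, ψ y * hermiteProd β (y - c • x))
      (∫ y, (ψ y * -c) • hermiteProdDeriv β (y - c • x₀)) x₀ := by
  obtain ⟨C, hC, hCb⟩ := exists_norm_hermiteProdDeriv_le β
  have hB0 : 0 ≤ B := (abs_nonneg _).trans (hB 0)
  have hbi : Integrable fun y : Euc d =>
      (B * |c| * (C * Real.exp (c ^ 2 / 4))) * Real.exp (-(1 / 8) * ‖y - c • x₀‖ ^ 2) :=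
    (integrable_exp_neg_mul_norm_sub_sq (by norm_num) (c • x₀)).const_mul _
  have hm : AEStronglyMeasurable
      (fun y => (ψ y * -c) • hermiteProdDeriv β (y - c • x₀)) volume :=
    (hψ.mul_const _).aestronglyMeasurable.smul
      ((continuous_hermiteProdDeriv β).comp (by fun_prop)).aestronglyMeasurable
  have hb : ∀ y, ∀ x ∈ Metric.ball x₀ 1, ‖(ψ y * -c) • hermiteProdDeriv β (y - c • x)‖ ≤
      (B * |c| * (C * Real.exp (c ^ 2 / 4))) * Real.exp (-(1 / 8) * ‖y - c • x₀‖ ^ 2) := by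
    intro y x hx
    rw [norm_smul, Real.norm_eq_abs, abs_mul, abs_neg, mul_assoc (B * |c|)]
    refine mul_le_mul (by gcongr; exact hB y) ((hCb _).trans ?_) (norm_nonneg _) (by positivity)
    rw [mul_assoc, ← Real.exp_add]
    gcongr
    have h1 : ‖y - c • x₀‖ ≤ ‖y - c • x‖ + |c| := by
      calc ‖y - c • x₀‖ = ‖(y - c • x) + c • (x - x₀)‖ := by congr 1; rw [smul_sub]; abel
        _ ≤ ‖y - c • x‖ + ‖c • (x - x₀)‖ := norm_add_le _ _
        _ ≤ ‖y - c • x‖ + |c| := by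
          rw [norm_smul, Real.norm_eq_abs]
          have : ‖x - x₀‖ ≤ 1 := (mem_ball_iff_norm.1 hx).le
          have := mul_le_mul_of_nonneg_left this (abs_nonneg c)
          linarith
    have h2 := pow_le_pow_left₀ (norm_nonneg _) h1 2
    nlinarith [sq_nonneg (‖y - c • x‖ - |c|), sq_abs c]
  refine ⟨hbi.mono' hm (ae_of_all _ fun y => hb y x₀ (Metric.mem_ball_self one_pos)),
    hasFDerivAt_integral_of_dominated_of_fderiv_le (Metric.ball_mem_nhds x₀ one_pos)
      (Filter.Eventually.of_forall fun x =>
        (integrable_mul_hermiteProd_sub hψ hB β (c • x)).aestronglyMeasurable)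
      (integrable_mul_hermiteProd_sub hψ hB β (c • x₀)) hm (ae_of_all _ hb) hbi
      (ae_of_all _ fun y x _ => ?_)⟩
  have h1 : HasFDerivAt (fun x : Euc d => y - c • x) (-(c • ContinuousLinearMap.id ℝ (Euc d))) x :=
    ((hasFDerivAt_id x).const_smul c).const_sub y
  refine (((hasFDerivAt_hermiteProd β (y - c • x)).comp x h1).const_mul (ψ y)).congr_fderiv ?_
  ext v
  simp
  ring

lemma pderivE_integral_hermiteProd {d : ℕ} {ψ : Euc d → ℝ} (hψ : Measurable ψ) {B : ℝ}
    (hB : ∀ y, |ψ y| ≤ B) (β : Fin d → ℕ) (a c : ℝ) (i : Fin d) :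
    pderivE i (fun x => a * ∫ y, ψ y * hermiteProd β (y - c • x)) =
      fun x => (a * c) * ∫ y, ψ y * hermiteProd (β + Pi.single i 1) (y - c • x) := by
  ext x
  obtain ⟨hi, hd⟩ := hasFDerivAt_integral_hermiteProd hψ hB β c x
  rw [pderivE, (hd.const_mul a).fderiv, smul_apply, ContinuousLinearMap.integral_apply hi,
    smul_eq_mul, mul_assoc a c, ← integral_const_mul c]
  congr 2
  ext y
  simp [hermiteProdDeriv]
  ring

lemma mdeg_add_single {d : ℕ} (β : Fin d → ℕ) (i : Fin d) :
    mdeg (β + Pi.single i 1) = mdeg β + 1 := by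
  simp [mdeg, Finset.sum_add_distrib]

lemma mderivE_of_pderivE {d : ℕ} (G : (Fin d → ℕ) → Euc d → ℝ)
    (hG : ∀ β i, pderivE i (G β) = G (β + Pi.single i 1)) (α : Fin d → ℕ) :
    mderivE α (G 0) = G α := by
  have hiter : ∀ (i : Fin d) (n : ℕ) β, (pderivE i)^[n] (G β) = G (β + Pi.single i n) := by
    intro i n
    induction n with
    | zero => simp
    | succ n ih =>
      intro β
      rw [Function.iterate_succ_apply, hG, ih, add_assoc, ← Pi.single_add, add_comm 1 n]
  have hl : ∀ l : List (Fin d), ((l.map fun i => (pderivE i)^[α i]).foldr (· ∘ ·) id) (G 0) =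
      G ((l.map fun i => Pi.single i (α i)).sum) := by
    intro l
    induction l with
    | nil => simp
    | cons i l ih =>
      simp only [List.map_cons, List.foldr_cons, Function.comp_apply, List.sum_cons]
      rw [ih, hiter, add_comm]
  rw [mderivE, List.ofFn_eq_map, hl, ← List.ofFn_eq_map, List.sum_ofFn, Finset.univ_sum_single]

lemma sq_integral_mul_le_of_weight {X : Type*} [MeasurableSpace X] {μ : Measure X}
    {f g w : X → ℝ} (hw : ∀ x, 0 ≤ w x) (hff : Integrable (fun x => f x ^ 2 * w x) μ)
    (hfg : Integrable (fun x => f x * (g x * w x)) μ)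
    (hgg : Integrable (fun x => g x * (g x * w x)) μ) :
    (∫ x, f x * (g x * w x) ∂μ) ^ 2 ≤
      (∫ x, f x ^ 2 * w x ∂μ) * ∫ x, g x * (g x * w x) ∂μ := by
  have h : ∀ r : ℝ, 0 ≤ (∫ x, g x * (g x * w x) ∂μ) * (r * r) +
      (2 * ∫ x, f x * (g x * w x) ∂μ) * r + ∫ x, f x ^ 2 * w x ∂μ := by
    intro r
    have h0 : 0 ≤ ∫ x, ((r * r) * (g x * (g x * w x)) + (2 * r) * (f x * (g x * w x))) +
        f x ^ 2 * w x ∂μ := by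
      refine integral_nonneg fun x => ?_
      have := mul_nonneg (sq_nonneg (f x + r * g x)) (hw x)
      simp only [Pi.zero_apply]
      linarith
    rw [integral_add (f := fun x => (r * r) * (g x * (g x * w x)) + (2 * r) * (f x * (g x * w x)))
        ((hgg.const_mul _).add (hfg.const_mul _)) hff,
      integral_add (hgg.const_mul _) (hfg.const_mul _), integral_const_mul,
      integral_const_mul] at h0
    linarith
  have := discrim_le_zero h
  rw [discrim] at this
  linarith

/-- The normalising constant `(2π)^{-d/2}`. -/
def gaussConst (d : ℕ) : ℝ := (2 * Real.pi) ^ (-(d : ℝ) / 2)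

lemma gaussConst_mul_sqrt_pow (d : ℕ) : gaussConst d * √(2 * π) ^ d = 1 := by
  have h : (0 : ℝ) < 2 * π := by positivity
  rw [gaussConst, Real.sqrt_eq_rpow, ← Real.rpow_natCast, ← Real.rpow_mul h.le,
    ← Real.rpow_add h]
  convert Real.rpow_zero _ using 2
  ring

lemma gaussConst_pos (d : ℕ) : 0 < gaussConst d := Real.rpow_pos_of_pos (by positivity) _

lemma integral_stdGaussian {d : ℕ} (f : Euc d → ℝ) :
    ∫ y, f y ∂(_root_.stdGaussian d) = gaussConst d * ∫ y, f y * Real.exp (-‖y‖ ^ 2 / 2) := by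
  rw [_root_.stdGaussian, integral_withDensity_eq_integral_toReal_smul (by fun_prop)
    (ae_of_all _ fun _ => ENNReal.ofReal_lt_top), ← integral_const_mul]
  congr 1
  ext y
  rw [ENNReal.toReal_ofReal (by positivity), smul_eq_mul,
    gaussConst]
  ring

lemma hermiteProd_eq {d : ℕ} (β : Fin d → ℕ) (y : Euc d) :
    hermiteProd β y = hermiteM β y * Real.exp (-‖y‖ ^ 2 / 2) := by
  simp only [hermiteProd, hermiteW, hermiteM]
  rw [Finset.prod_mul_distrib, exp_neg_norm_sq_eq_prod]

lemma hermiteM_zero {d : ℕ} (y : Euc d) : hermiteM 0 y = 1 := by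
  simp [hermiteM, hermiteR]

lemma integrable_hermiteM_mul_hermiteProd {d : ℕ} (α β : Fin d → ℕ) :
    Integrable fun y : Euc d => hermiteM α y * hermiteProd β y := by
  have h := integrable_bounded_mul_prod (d := d) (ψ := fun _ => 1) measurable_const (B := 1)
    (by simp) (fun i => Polynomial.hermite (α i) * Polynomial.hermite (β i))
  refine h.congr (ae_of_all _ fun y => ?_)
  simp [hermiteM, hermiteProd, hermiteW, hermiteR, Finset.prod_mul_distrib, mul_assoc]

lemma gaussConst_mul_integral_hermiteM_sq {d : ℕ} (α : Fin d → ℕ) :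
    gaussConst d * ∫ y : Euc d, hermiteM α y * hermiteProd α y = mfact α := by
  have h : ∫ y : Euc d, hermiteM α y * hermiteProd α y =
      ∏ i, ∫ u : ℝ, hermiteR (α i) u * hermiteW (α i) u := by
    rw [← integral_fintype_prod_volume_eq_prod
      (fun (i : Fin d) (u : ℝ) => hermiteR (α i) u * hermiteW (α i) u),
      ← (PiLp.volume_preserving_toLp (Fin d)).integral_comp
        (MeasurableEquiv.toLp 2 _).measurableEmbedding]
    simp [hermiteM, hermiteProd, Finset.prod_mul_distrib]
  rw [h]
  simp only [integral_hermiteR_mul_hermiteW_self, Finset.prod_mul_distrib, Finset.prod_const,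
    Finset.card_univ, Fintype.card_fin, mfact]
  push_cast
  rw [mul_left_comm, gaussConst_mul_sqrt_pow, mul_one]

lemma integral_mul_hermiteProd_sub {d : ℕ} (φ : Euc d → ℝ) (β : Fin d → ℕ) {a s : ℝ} (hs : s ≠ 0)
    (x : Euc d) :
    ∫ y, φ (s • y) * hermiteProd β (y - (a / s) • x) =
      ∫ y, φ (a • x + s • y) * hermiteProd β y := by
  rw [← integral_add_right_eq_self _ ((a / s) • x)]
  congr 1
  ext y
  rw [smul_add, smul_smul, mul_div_cancel₀ _ hs, add_sub_cancel_right, add_comm]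

lemma sq_exp_neg_div_sqrt {t : ℝ} (ht : 0 < t) :
    (Real.exp (-t) / √(1 - Real.exp (-2 * t))) ^ 2 = 1 / (Real.exp (2 * t) - 1) := by
  have h1 : Real.exp (-2 * t) < 1 := Real.exp_lt_one_iff.2 (by linarith)
  have h2 : 1 < Real.exp (2 * t) := Real.one_lt_exp_iff.2 (by linarith)
  rw [div_pow, Real.sq_sqrt (by linarith), div_eq_div_iff (by linarith) (by linarith),
    ← Real.exp_nat_mul]
  have h3 : Real.exp (-2 * t) * Real.exp (2 * t) = 1 := by rw [← Real.exp_add]; simp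
  rw [show ((2 : ℕ) : ℝ) * -t = -2 * t by push_cast; ring]
  linarith

lemma OU_eq {d : ℕ} (t : ℝ) (φ : Euc d → ℝ) (x : Euc d) :
    OU t φ x = gaussConst d *
      ∫ y, φ (Real.exp (-t) • x + √(1 - Real.exp (-2 * t)) • y) * hermiteProd 0 y := by
  simp only [OU, integral_stdGaussian, hermiteProd_eq, hermiteM_zero, one_mul]

lemma mderivE_OU {d : ℕ} {t : ℝ} (ht : 0 < t) {φ : Euc d → ℝ} (hφm : Measurable φ) {B : ℝ}
    (hφb : ∀ x, |φ x| ≤ B) (α : Fin d → ℕ) (x : Euc d) :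
    mderivE α (OU t φ) x =
      gaussConst d * (Real.exp (-t) / √(1 - Real.exp (-2 * t))) ^ mdeg α *
        ∫ y, φ (Real.exp (-t) • x + √(1 - Real.exp (-2 * t)) • y) * hermiteProd α y := by
  have hs : √(1 - Real.exp (-2 * t)) ≠ 0 := by
    have h1 : Real.exp (-2 * t) < 1 := Real.exp_lt_one_iff.2 (by linarith)
    exact (Real.sqrt_pos.2 (by linarith)).ne'
  set s := √(1 - Real.exp (-2 * t))
  set c := Real.exp (-t) / s with hc
  let G : (Fin d → ℕ) → Euc d → ℝ := fun β x => gaussConst d * c ^ mdeg β *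
      ∫ y, φ (s • y) * hermiteProd β (y - c • x)
  have h0 : OU t φ = G 0 := by
    ext x
    simp only [G, hc]
    rw [OU_eq, integral_mul_hermiteProd_sub φ 0 hs]
    simp [mdeg, s]
  rw [h0, mderivE_of_pderivE G]
  · simp only [G, hc]
    rw [integral_mul_hermiteProd_sub φ α hs]
  · intro β i
    simp only [G, mdeg_add_single, pow_succ, ← mul_assoc]
    exact pderivE_integral_hermiteProd (ψ := fun y => φ (s • y)) (hφm.comp (by fun_prop))
      (fun y => hφb _) β _ c i

theorem OU_deriv_sq_bound
    {d : ℕ} (t : ℝ) (ht : 0 < t)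
    (φ : Euc d → ℝ) (hφm : Measurable φ) (B : ℝ) (hφb : ∀ x, |φ x| ≤ B)
    (α : Fin d → ℕ) :
    ∀ x : Euc d,
      (mderivE α (OU t φ) x) ^ 2 ≤
        (mfact α : ℝ) / (Real.exp (2 * t) - 1) ^ mdeg α * OU t (fun y => φ y ^ 2) x ∧
      (mfact α : ℝ) / (Real.exp (2 * t) - 1) ^ mdeg α * OU t (fun y => φ y ^ 2) x ≤
        B ^ 2 * (mfact α : ℝ) / (Real.exp (2 * t) - 1) ^ mdeg α := by
  intro x
  have h2 : 1 < Real.exp (2 * t) := Real.one_lt_exp_iff.2 (by linarith)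
  have hD : 0 < Real.exp (2 * t) - 1 := by linarith
  set f : Euc d → ℝ := fun y => φ (Real.exp (-t) • x + √(1 - Real.exp (-2 * t)) • y) with hf
  have hfm : Measurable f := hφm.comp (by fun_prop)
  have hfb : ∀ y, |f y| ≤ B := fun y => hφb _
  have hf2b : ∀ y, |f y ^ 2| ≤ B ^ 2 := fun y => by
    rw [abs_pow]; exact pow_le_pow_left₀ (abs_nonneg _) (hfb y) 2
  have hK := gaussConst_pos d
  have hff : Integrable fun y => f y ^ 2 * hermiteProd 0 y := by
    simpa using integrable_mul_hermiteProd_sub (hfm.pow_const 2) hf2b 0 0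
  have hOU : OU t (fun y => φ y ^ 2) x = gaussConst d * ∫ y, f y ^ 2 * hermiteProd 0 y :=
    OU_eq t _ x
  have hnonneg : 0 ≤ (mfact α : ℝ) / (Real.exp (2 * t) - 1) ^ mdeg α := by positivity
  constructor
  · have hcs : (∫ y, f y * hermiteProd α y) ^ 2 ≤
        (∫ y, f y ^ 2 * hermiteProd 0 y) * ∫ y, hermiteM α y * hermiteProd α y := by
      have hfg : Integrable fun y => f y * hermiteProd α y := by
        simpa using integrable_mul_hermiteProd_sub hfm hfb α 0
      have hgg := integrable_hermiteM_mul_hermiteProd α α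
      simp only [hermiteProd_eq, hermiteM_zero, one_mul] at hff hfg hgg ⊢
      exact sq_integral_mul_le_of_weight (fun y => (Real.exp_pos _).le) hff hfg hgg
    rw [mderivE_OU ht hφm hφb, hOU, ← gaussConst_mul_integral_hermiteM_sq, mul_pow, mul_pow,
      ← pow_mul, mul_comm (mdeg α) 2, pow_mul, sq_exp_neg_div_sqrt ht]
    calc _ ≤ gaussConst d ^ 2 * (1 / (Real.exp (2 * t) - 1)) ^ mdeg α *
          ((∫ y, f y ^ 2 * hermiteProd 0 y) * ∫ y, hermiteM α y * hermiteProd α y) := by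
          gcongr
      _ = _ := by rw [div_pow, one_pow]; ring
  · rw [mul_comm (B ^ 2), mul_div_right_comm]
    refine mul_le_mul_of_nonneg_left ?_ hnonneg
    have h1 := gaussConst_mul_integral_hermiteM_sq (0 : Fin d → ℕ)
    have h1i := integrable_hermiteM_mul_hermiteProd (0 : Fin d → ℕ) 0
    simp only [hermiteM_zero, one_mul, mfact, Pi.zero_apply, Nat.factorial_zero,
      Finset.prod_const_one, Nat.cast_one] at h1 h1i
    calc OU t (fun y => φ y ^ 2) x = gaussConst d * ∫ y, f y ^ 2 * hermiteProd 0 y := hOU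
      _ ≤ gaussConst d * ∫ y : Euc d, B ^ 2 * hermiteProd 0 y := by
        refine mul_le_mul_of_nonneg_left (integral_mono hff (h1i.const_mul _) fun y => ?_) hK.le
        refine mul_le_mul_of_nonneg_right ((le_abs_self _).trans (hf2b y)) ?_
        rw [hermiteProd_eq, hermiteM_zero, one_mul]
        exact (Real.exp_pos _).le
      _ = B ^ 2 := by rw [integral_const_mul, mul_left_comm, h1, mul_one]

end
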